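/- arXiv:2012.00345 — 2 statements merged into one kernel-verified Lean document; each statement's English description precedes it below -/
import Mathlib

section
/- For every feasible quantile function G, the objective value of G is at most max(1/δ, γ*)·x (where this bound is interpreted as +∞ when γ* = +∞). -/
open MeasureTheory Set Filter Topology ENNReal

noncomputable section

/-- The CDF of a random variable `ρ` under the measure `μ`. -/
def cdfFun {Ω : Type*} [MeasurableSpace Ω] (μ : Measure Ω) (ρ : Ω → ℝ) : ℝ → ℝ :=
  fun t => (μ {ω | ρ ω ≤ t}).toReal

/-- The right-continuous quantile function of `ρ`:
`F_ρ⁻¹(z) = inf {t : F_ρ(t) > z}`. -/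
def rcInv {Ω : Type*} [MeasurableSpace Ω] (μ : Measure Ω) (ρ : Ω → ℝ) : ℝ → ℝ :=
  fun z => sInf {t : ℝ | z < cdfFun μ ρ t}

/-- A feasible quantile function for pricing-density `F = F_ρ⁻¹` and initial wealth `x`:
nondecreasing and right-continuous on `(0,1)`, with `lim_{z↓0} G(z) ≥ 0`, satisfying the
budget constraint `∫_0^1 F(1-z) G(z) dz ≤ x`. -/
def Feasible (F : ℝ → ℝ) (x : ℝ) (G : ℝ → ℝ) : Prop :=
  MonotoneOn G (Set.Ioo 0 1)
  ∧ (∀ z ∈ Set.Ioo (0:ℝ) 1, Filter.Tendsto G (nhdsWithin z (Set.Ioi z)) (nhds (G z)))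
  ∧ (∃ L, 0 ≤ L ∧ Filter.Tendsto G (nhdsWithin 0 (Set.Ioi 0)) (nhds L))
  ∧ ∫⁻ z in Set.Ioo (0:ℝ) 1, ENNReal.ofReal (F (1 - z) * G z) ≤ ENNReal.ofReal x

/-- The extension `Ḡ` of a (nonnegative) quantile function `G` from `(0,1)` to `[0,1]`,
valued in `[0,∞]`, with `Ḡ(0) = lim_{z↓0} G(z)` and `Ḡ(1) = lim_{z↑1} G(z)`
(these limits are the inf/sup over `(0,1)` since `G` is nondecreasing). -/
def Gbar (G : ℝ → ℝ) : ℝ → ℝ≥0∞ := fun z =>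
  if z = 0 then ⨅ y ∈ Set.Ioo (0:ℝ) 1, ENNReal.ofReal (G y)
  else if z = 1 then ⨆ y ∈ Set.Ioo (0:ℝ) 1, ENNReal.ofReal (G y)
  else ENNReal.ofReal (G z)

/-- The objective value `∫_{[0,1]} Ḡ(z) m(dz)` of a quantile function `G`
(for `m` a Borel probability measure carried by `[0,1]`). -/
def objVal (m : Measure ℝ) (G : ℝ → ℝ) : ℝ≥0∞ := ∫⁻ z, Gbar G z ∂m

/-- `ζ(c) = m([c,1]) / ∫_c^1 F(1-z) dz`. -/
def zeta (F : ℝ → ℝ) (m : Measure ℝ) (c : ℝ) : ℝ :=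
  (m (Set.Icc c 1)).toReal / ∫ z in c..1, F (1 - z)

theorem rcInv_pos {Ω : Type*} [MeasurableSpace Ω] (μ : Measure Ω) [IsProbabilityMeasure μ]
    {ρ : Ω → ℝ} (hρmeas : Measurable ρ) (hρpos : ∀ ω, 0 < ρ ω) (hcdf : Continuous (cdfFun μ ρ))
    {z : ℝ} (hz : z ∈ Ioo (0 : ℝ) 1) : 0 < rcInv μ ρ z := by
  have hmono : Monotone (cdfFun μ ρ) := fun s t hst =>
    ENNReal.toReal_mono (measure_ne_top _ _) (measure_mono fun ω (hω : ρ ω ≤ s) => hω.trans hst)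
  have hzero : cdfFun μ ρ 0 = 0 := by
    have : {ω | ρ ω ≤ 0} = ∅ := by
      ext ω
      simpa using hρpos ω
    simp [cdfFun, this]
  have hlim : Tendsto (cdfFun μ ρ) atTop (𝓝 1) := by
    have : IsProbabilityMeasure (μ.map ρ) := Measure.isProbabilityMeasure_map hρmeas.aemeasurable
    refine (ProbabilityTheory.tendsto_cdf_atTop (μ.map ρ)).congr fun t => ?_
    rw [ProbabilityTheory.cdf_eq_real, measureReal_def, Measure.map_apply hρmeas measurableSet_Iic]
    rfl
  obtain ⟨t, ht⟩ := (hlim.eventually (lt_mem_nhds hz.2)).exists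
  have hnear : ∀ᶠ s in 𝓝[>] (0 : ℝ), cdfFun μ ρ s < z :=
    (hcdf.continuousAt.eventually (gt_mem_nhds (hzero.symm ▸ hz.1))).filter_mono
      nhdsWithin_le_nhds
  obtain ⟨ε, hεz, hε⟩ := (hnear.and self_mem_nhdsWithin).exists
  refine lt_of_lt_of_le hε (le_csInf ⟨t, ht⟩ fun s hs => ?_)
  exact (hmono.reflect_lt (hεz.trans hs)).le

/-- The layer-cake formula for functions valued in `[0,∞]`. -/
theorem lintegral_eq_lintegral_meas_ofReal_lt {α : Type*} [MeasurableSpace α] (ν : Measure α)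
    [SFinite ν] {f : α → ℝ≥0∞} (hf : AEMeasurable f ν) :
    ∫⁻ a, f a ∂ν = ∫⁻ s in Ioi (0 : ℝ), ν {a | ENNReal.ofReal s < f a} := by
  wlog hfm : Measurable f generalizing f
  · rw [lintegral_congr_ae hf.ae_eq_mk, this hf.measurable_mk.aemeasurable hf.measurable_mk]
    refine lintegral_congr fun s => measure_congr ?_
    filter_upwards [hf.ae_eq_mk] with a ha
    change (_ < _) = (_ < _)
    rw [ha]
  have hvol : ∀ b : ℝ≥0∞, b = ∫⁻ s in Ioi (0 : ℝ), {s | ENNReal.ofReal s < b}.indicator 1 s := by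
    intro b
    rw [lintegral_indicator_one (measurableSet_lt ENNReal.measurable_ofReal measurable_const),
      Measure.restrict_apply (measurableSet_lt ENNReal.measurable_ofReal measurable_const)]
    induction b with
    | top => simp
    | coe r =>
      have : {s : ℝ | ENNReal.ofReal s < r} ∩ Ioi 0 = Ioo 0 (r : ℝ) := by
        ext s
        constructor
        · rintro ⟨h, hs⟩
          exact ⟨hs, by simpa using (ENNReal.ofReal_lt_coe_iff (le_of_lt hs)).1 h⟩
        · rintro ⟨hs, h⟩
          exact ⟨(ENNReal.ofReal_lt_coe_iff hs.le).2 h, hs⟩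
      rw [this]
      simp
  have hset : MeasurableSet {p : α × ℝ | ENNReal.ofReal p.2 < f p.1} :=
    measurableSet_lt (by fun_prop) (by fun_prop)
  calc ∫⁻ a, f a ∂ν
      = ∫⁻ a, (∫⁻ s in Ioi (0 : ℝ),
          {p : α × ℝ | ENNReal.ofReal p.2 < f p.1}.indicator 1 (a, s)) ∂ν :=
        lintegral_congr fun a => hvol (f a)
    _ = ∫⁻ s in Ioi (0 : ℝ), ∫⁻ a,
          {p : α × ℝ | ENNReal.ofReal p.2 < f p.1}.indicator 1 (a, s) ∂ν :=
        lintegral_lintegral_swap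
          (f := fun a s => {p : α × ℝ | ENNReal.ofReal p.2 < f p.1}.indicator 1 (a, s))
          (measurable_one.indicator hset).aemeasurable
    _ = ∫⁻ s in Ioi (0 : ℝ), ν {a | ENNReal.ofReal s < f a} :=
        lintegral_congr fun s =>
          lintegral_indicator_one (s := {a | ENNReal.ofReal s < f a})
            (measurableSet_lt measurable_const hfm)

theorem Gbar_of_mem_Ioo (G : ℝ → ℝ) {z : ℝ} (hz : z ∈ Ioo (0 : ℝ) 1) :
    Gbar G z = ENNReal.ofReal (G z) := by
  simp [Gbar, hz.1.ne', hz.2.ne]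

theorem Gbar_zero_le (G : ℝ → ℝ) {y : ℝ} (hy : y ∈ Ioo (0 : ℝ) 1) :
    Gbar G 0 ≤ ENNReal.ofReal (G y) := by
  simpa only [Gbar, if_true] using
    iInf₂_le (f := fun y (_ : y ∈ Ioo (0 : ℝ) 1) => ENNReal.ofReal (G y)) y hy

theorem Gbar_one (G : ℝ → ℝ) : Gbar G 1 = ⨆ y ∈ Ioo (0 : ℝ) 1, ENNReal.ofReal (G y) := by
  simp [Gbar]

theorem le_Gbar_one (G : ℝ → ℝ) {y : ℝ} (hy : y ∈ Ioo (0 : ℝ) 1) :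
    ENNReal.ofReal (G y) ≤ Gbar G 1 := by
  rw [Gbar_one]
  exact le_iSup₂ (f := fun y (_ : y ∈ Ioo (0 : ℝ) 1) => ENNReal.ofReal (G y)) y hy

theorem monotoneOn_Gbar {G : ℝ → ℝ} (hG : MonotoneOn G (Ioo 0 1)) :
    MonotoneOn (Gbar G) (Icc 0 1) := by
  intro a ha b hb hab
  have half : (1 / 2 : ℝ) ∈ Ioo (0 : ℝ) 1 := by constructor <;> norm_num
  rcases ha.1.eq_or_lt with rfl | ha0
  · rcases hb.1.eq_or_lt with rfl | hb0
    · exact le_rfl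
    rcases hb.2.eq_or_lt with rfl | hb1
    · exact (Gbar_zero_le G half).trans (le_Gbar_one G half)
    · exact (Gbar_zero_le G ⟨hb0, hb1⟩).trans (Gbar_of_mem_Ioo G ⟨hb0, hb1⟩).ge
  · rcases hb.2.eq_or_lt with rfl | hb1
    · rcases ha.2.eq_or_lt with rfl | ha1
      · exact le_rfl
      · exact (Gbar_of_mem_Ioo G ⟨ha0, ha1⟩).le.trans (le_Gbar_one G ⟨ha0, ha1⟩)
    · have ha' : a ∈ Ioo (0 : ℝ) 1 := ⟨ha0, hab.trans_lt hb1⟩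
      have hb' : b ∈ Ioo (0 : ℝ) 1 := ⟨ha0.trans_le hab, hb1⟩
      rw [Gbar_of_mem_Ioo G ha', Gbar_of_mem_Ioo G hb']
      exact ENNReal.ofReal_le_ofReal (hG ha' hb' hab)

/-- Superlevel sets of `Gbar G` under `m` are controlled by those of `G` under any measure `ν`
dominating `m` up to the factor `M` on `(0,1)` and on each tail `(c,1)`. -/
theorem meas_lt_Gbar_le {m ν : Measure ℝ} [IsProbabilityMeasure m] {M : ℝ≥0∞}
    (hm : m (Icc (0 : ℝ) 1)ᶜ = 0) (hfull : 1 ≤ M * ν (Ioo 0 1))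
    (htail : ∀ c ∈ Ioo (0 : ℝ) 1, m (Icc c 1) ≤ M * ν (Ioo c 1))
    {G : ℝ → ℝ} (hG : MonotoneOn G (Ioo 0 1)) (s : ℝ≥0∞) :
    m {z | s < Gbar G z} ≤ M * ν {z | s < ENNReal.ofReal (G z)} := by
  by_cases hall : ∀ y ∈ Ioo (0 : ℝ) 1, s < ENNReal.ofReal (G y)
  · exact prob_le_one.trans (hfull.trans (by gcongr; exact hall))
  push Not at hall
  obtain ⟨y, hy, hys⟩ := hall
  have hsupp : ∀ B : Set ℝ, {z | s < Gbar G z} ∩ Icc 0 1 ⊆ B → m {z | s < Gbar G z} ≤ m B := by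
    intro B hB
    rw [← measure_inter_add_sdiff {z | s < Gbar G z} (measurableSet_Icc (a := (0 : ℝ)) (b := 1)),
      measure_mono_null (fun z hz => hz.2 : {z | s < Gbar G z} \ Icc 0 1 ⊆ (Icc (0 : ℝ) 1)ᶜ) hm,
      add_zero]
    exact measure_mono hB
  set A : Set ℝ := {z | z ∈ Ioo (0 : ℝ) 1 ∧ s < ENNReal.ofReal (G z)}
  have hAy : ∀ z ∈ A, y ≤ z := fun z hz => le_of_not_gt fun hzy =>
    (hz.2.trans_le (ENNReal.ofReal_le_ofReal (hG hz.1 hy hzy.le))).not_ge hys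
  have hbdd : BddBelow A := ⟨y, hAy⟩
  have hlt_zero : ¬ s < Gbar G 0 := fun h => (h.trans_le (Gbar_zero_le G hy)).not_ge hys
  rcases A.eq_empty_or_nonempty with hA | ⟨w, hw⟩
  · have hempty : {z | s < Gbar G z} ∩ Icc 0 1 ⊆ ∅ := by
      rintro z ⟨hz, hz0, hz1⟩
      rcases hz0.eq_or_lt with rfl | hz0
      · exact hlt_zero hz
      rcases hz1.eq_or_lt with rfl | hz1
      · rw [mem_ofPred_eq, Gbar_one] at hz
        simp only [lt_iSup_iff] at hz
        obtain ⟨v, hv, hsv⟩ := hz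
        exact (hA ▸ (⟨hv, hsv⟩ : v ∈ A) : v ∈ (∅ : Set ℝ)).elim
      · exact hA.subset ⟨⟨hz0, hz1⟩, Gbar_of_mem_Ioo G ⟨hz0, hz1⟩ ▸ hz⟩
    exact (hsupp ∅ hempty).trans (by simp)
  · have hc : sInf A ∈ Ioo (0 : ℝ) 1 :=
      ⟨hy.1.trans_le (le_csInf ⟨w, hw⟩ hAy), (csInf_le hbdd hw).trans_lt hw.1.2⟩
    refine (hsupp (Icc (sInf A) 1) ?_).trans ((htail _ hc).trans ?_)
    · rintro z ⟨hz, hz0, hz1⟩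
      refine ⟨?_, hz1⟩
      rcases hz0.eq_or_lt with rfl | hz0
      · exact absurd hz hlt_zero
      rcases hz1.eq_or_lt with rfl | hz1
      · exact hc.2.le
      · exact csInf_le hbdd ⟨⟨hz0, hz1⟩, Gbar_of_mem_Ioo G ⟨hz0, hz1⟩ ▸ hz⟩
    · gcongr
      intro z hz
      obtain ⟨v, hv, hvz⟩ := exists_lt_of_csInf_lt ⟨w, hw⟩ hz.1
      exact hv.2.trans_le
        (ENNReal.ofReal_le_ofReal (hG hv.1 ⟨hc.1.trans hz.1, hz.2⟩ hvz.le))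

/-- every feasible quantile function has objective value at most
`max(1/δ, γ*)·x` (in `[0,∞]`, so the bound is `+∞` when `γ* = +∞`). -/
theorem objVal_le_max_of_feasible
    {Ω : Type*} [MeasurableSpace Ω] (μ : Measure Ω) [IsProbabilityMeasure μ]
    (ρ : Ω → ℝ) (hρmeas : Measurable ρ) (hρpos : ∀ ω, 0 < ρ ω)
    (hρint : Integrable ρ μ) (hcdf : Continuous (cdfFun μ ρ))
    (m : Measure ℝ) [IsProbabilityMeasure m] (hm : m (Set.Icc (0:ℝ) 1)ᶜ = 0)
    (x δ : ℝ) (hx : 0 < x) (hδpos : 0 < δ)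
    (hδ1 : δ = ∫ ω, ρ ω ∂μ) (hδ2 : δ = ∫ z in (0:ℝ)..1, rcInv μ ρ (1 - z)) :
    ∀ G : ℝ → ℝ, Feasible (rcInv μ ρ) x G →
      objVal m G ≤ max (ENNReal.ofReal (1 / δ))
        (⨆ c ∈ Set.Ioo (0:ℝ) 1, ENNReal.ofReal (zeta (rcInv μ ρ) m c)) * ENNReal.ofReal x := by
  intro G hG
  obtain ⟨hmono, -, -, hbudget⟩ := hG
  set F : ℝ → ℝ := fun z => rcInv μ ρ (1 - z)
  set M := max (ENNReal.ofReal (1 / δ))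
    (⨆ c ∈ Set.Ioo (0:ℝ) 1, ENNReal.ofReal (zeta (rcInv μ ρ) m c))
  have hFpos : ∀ z ∈ Ioo (0 : ℝ) 1, 0 < F z := fun z hz =>
    rcInv_pos μ hρmeas hρpos hcdf ⟨by linarith [hz.2], by linarith [hz.1]⟩
  have hFint : IntervalIntegrable F volume 0 1 := by
    by_contra h
    rw [intervalIntegral.integral_undef h] at hδ2
    exact hδpos.ne' hδ2
  have hFon : IntegrableOn F (Ioo 0 1) := by
    rw [← intervalIntegrable_iff_integrableOn_Ioo_of_le zero_le_one]
    exact hFint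
  set ν := (volume.restrict (Ioo (0 : ℝ) 1)).withDensity fun z => ENNReal.ofReal (F z)
  have hν : ∀ c ∈ Ico (0 : ℝ) 1, ν (Ioo c 1) = ENNReal.ofReal (∫ z in c..1, F z) := by
    intro c hc
    have hsub : Ioo c 1 ⊆ Ioo 0 1 := Ioo_subset_Ioo_left hc.1
    rw [withDensity_apply _ measurableSet_Ioo, Measure.restrict_restrict measurableSet_Ioo,
      inter_eq_left.2 hsub, intervalIntegral.integral_of_le hc.2.le, integral_Ioc_eq_integral_Ioo,
      ofReal_integral_eq_lintegral_ofReal (hFon.mono_set hsub)]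
    filter_upwards [ae_restrict_mem measurableSet_Ioo] with z hz
    exact (hFpos z (hsub hz)).le
  have hfull : 1 ≤ M * ν (Ioo 0 1) := by
    rw [hν 0 ⟨le_rfl, zero_lt_one⟩, ← hδ2]
    calc (1 : ℝ≥0∞) = ENNReal.ofReal (1 / δ) * ENNReal.ofReal δ := by
          rw [← ENNReal.ofReal_mul (by positivity), one_div_mul_cancel hδpos.ne',
            ENNReal.ofReal_one]
      _ ≤ M * ENNReal.ofReal δ := by
          gcongr
          exact le_max_left _ _
  have htail : ∀ c ∈ Ioo (0 : ℝ) 1, m (Icc c 1) ≤ M * ν (Ioo c 1) := by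
    intro c hc
    have hI : 0 < ∫ z in c..1, F z := by
      refine intervalIntegral.intervalIntegral_pos_of_pos_on ?_
        (fun z hz => hFpos z ⟨hc.1.trans hz.1, hz.2⟩) hc.2
      exact hFint.mono_set (by
        rw [uIcc_of_le hc.2.le, uIcc_of_le zero_le_one]
        exact Icc_subset_Icc_left hc.1.le)
    have hζ : zeta (rcInv μ ρ) m c * ∫ z in c..1, F z = (m (Icc c 1)).toReal :=
      div_mul_cancel₀ _ hI.ne'
    rw [hν c ⟨hc.1.le, hc.2⟩, ← ENNReal.ofReal_toReal (measure_ne_top m (Icc c 1)), ← hζ,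
      ENNReal.ofReal_mul' hI.le]
    gcongr
    exact le_max_of_le_right
      (le_iSup₂ (f := fun c (_ : c ∈ Ioo (0 : ℝ) 1) => ENNReal.ofReal (zeta (rcInv μ ρ) m c)) c hc)
  have hmrestrict : m.restrict (Icc 0 1) = m :=
    Measure.restrict_eq_self_of_ae_mem (mem_ae_iff.2 hm)
  have hGbar : AEMeasurable (Gbar G) m := by
    rw [← hmrestrict]
    exact aemeasurable_restrict_of_monotoneOn measurableSet_Icc (monotoneOn_Gbar hmono)
  have hGmeas : AEMeasurable (fun z => ENNReal.ofReal (G z)) (volume.restrict (Ioo (0 : ℝ) 1)) :=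
    (aemeasurable_restrict_of_monotoneOn measurableSet_Ioo hmono).ennreal_ofReal
  have hFmeas : AEMeasurable (fun z => ENNReal.ofReal (F z)) (volume.restrict (Ioo (0 : ℝ) 1)) :=
    hFon.aemeasurable.ennreal_ofReal
  have hGν : AEMeasurable (fun z => ENNReal.ofReal (G z)) ν :=
    hGmeas.mono_ac (withDensity_absolutelyContinuous _ _)
  have hbudget_eq : ∫⁻ z in Ioo (0 : ℝ) 1, ENNReal.ofReal (F z * G z) =
      ∫⁻ z, ENNReal.ofReal (G z) ∂ν := by
    rw [lintegral_withDensity_eq_lintegral_mul₀ hFmeas hGmeas]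
    refine setLIntegral_congr_fun measurableSet_Ioo fun z hz => ?_
    exact ENNReal.ofReal_mul (hFpos z hz).le
  calc objVal m G = ∫⁻ s in Ioi (0 : ℝ), m {z | ENNReal.ofReal s < Gbar G z} :=
        lintegral_eq_lintegral_meas_ofReal_lt m hGbar
    _ ≤ ∫⁻ s in Ioi (0 : ℝ), M * ν {z | ENNReal.ofReal s < ENNReal.ofReal (G z)} :=
        lintegral_mono fun s => meas_lt_Gbar_le hm hfull htail hmono _
    _ = M * ∫⁻ z, ENNReal.ofReal (G z) ∂ν := by
        rw [lintegral_eq_lintegral_meas_ofReal_lt ν hGν, lintegral_const_mul]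
        refine Antitone.measurable fun s t hst => measure_mono fun z hz => ?_
        exact (ENNReal.ofReal_le_ofReal hst).trans_lt hz
    _ ≤ M * ENNReal.ofReal x := by
        gcongr
        exact hbudget_eq ▸ hbudget
end
end

section
/- Suppose 1/δ < γ* < +∞ and ζ(c) < γ* for every c ∈ (0,1). If G is a feasible quantile function that is not constant on (0,1), then the objective value of G is strictly less than γ*·x. -/
open MeasureTheory Set Filter Topology ENNReal

noncomputable section

section Quantile

variable {Ω : Type*} [MeasurableSpace Ω] {μ : Measure Ω} {ρ : Ω → ℝ}

theorem exists_lt_cdfFun [IsProbabilityMeasure μ] (hρ : Measurable ρ) {u : ℝ} (hu : u < 1) :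
    {t : ℝ | u < cdfFun μ ρ t}.Nonempty := by
  have : IsProbabilityMeasure (μ.map ρ) := Measure.isProbabilityMeasure_map hρ.aemeasurable
  obtain ⟨t, ht⟩ :=
    ((ProbabilityTheory.tendsto_cdf_atTop (μ.map ρ)).eventually (lt_mem_nhds hu)).exists
  refine ⟨t, ?_⟩
  rw [ProbabilityTheory.cdf_eq_real, map_measureReal_apply hρ measurableSet_Iic] at ht
  exact ht

theorem cdfFun_mono [IsProbabilityMeasure μ] : Monotone (cdfFun μ ρ) := fun _ _ hst =>
  ENNReal.toReal_mono (measure_ne_top _ _) (measure_mono fun _ hω => le_trans hω hst)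

theorem cdfFun_zero (hpos : ∀ ω, 0 < ρ ω) : cdfFun μ ρ 0 = 0 := by
  have : {ω | ρ ω ≤ 0} = ∅ := by
    ext ω
    simpa using hpos ω
  simp [cdfFun, this]

theorem rcInv_pos_s7 [IsProbabilityMeasure μ] (hρ : Measurable ρ) (hpos : ∀ ω, 0 < ρ ω)
    (hcdf : Continuous (cdfFun μ ρ)) {u : ℝ} (hu : u ∈ Ioo (0 : ℝ) 1) : 0 < rcInv μ ρ u := by
  have h : ∀ᶠ t in 𝓝[>] (0 : ℝ), cdfFun μ ρ t < u := by
    refine (hcdf.tendsto 0).mono_left nhdsWithin_le_nhds |>.eventually (gt_mem_nhds ?_)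
    rw [cdfFun_zero hpos]
    exact hu.1
  obtain ⟨ε, hε, hε0⟩ := (h.and self_mem_nhdsWithin).exists
  refine lt_of_lt_of_le hε0 (le_csInf (exists_lt_cdfFun hρ hu.2) fun t ht => ?_)
  by_contra! hlt
  exact absurd (lt_of_lt_of_le ht (cdfFun_mono hlt.le)) hε.le.not_gt

end Quantile

/-- Layer-cake comparison: a strict bound of tail masses gives a strict bound of integrals. -/
theorem lintegral_lt_of_tail_lt {α : Type*} [MeasurableSpace α] {m ν : Measure α} {g : α → ℝ}
    (hg : ∀ z, 0 ≤ g z) (hgm : AEMeasurable g m) (hgν : AEMeasurable g ν)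
    (htail : ∀ t, 0 < t → {z | t < g z}.Nonempty → m {z | t < g z} < ν {z | t < g z})
    {w : α} (hw : 0 < g w) (hfin : ∫⁻ z, ENNReal.ofReal (g z) ∂ν ≠ ∞) :
    ∫⁻ z, ENNReal.ofReal (g z) ∂m < ∫⁻ z, ENNReal.ofReal (g z) ∂ν := by
  have hle : ∀ t ∈ Ioi (0 : ℝ), m {z | t < g z} ≤ ν {z | t < g z} := by
    intro t ht
    rcases {z | t < g z}.eq_empty_or_nonempty with h | h
    · simp [h]
    · exact (htail t ht h).le
  have anti (κ : Measure α) : Antitone fun t : ℝ => κ {z | t < g z} := fun s t hst =>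
    measure_mono fun z hz => lt_of_le_of_lt hst hz
  rw [lintegral_eq_lintegral_meas_lt ν (.of_forall hg) hgν] at hfin ⊢
  rw [lintegral_eq_lintegral_meas_lt m (.of_forall hg) hgm]
  refine lintegral_strict_mono_of_ae_le_of_ae_lt_on (s := Ioo 0 (g w))
    (anti ν).measurable.aemeasurable ?_ ?_ ?_ ?_
  · exact ne_top_of_le_ne_top hfin (setLIntegral_mono (anti ν).measurable hle)
  · exact (ae_restrict_iff' measurableSet_Ioi).2 (.of_forall hle)
  · rw [Measure.restrict_apply measurableSet_Ioo,
      inter_eq_left.2 (Ioo_subset_Ioi_self : Ioo 0 (g w) ⊆ Ioi 0)]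
    simpa using hw
  · exact .of_forall fun t ht => htail t ht.1 ⟨w, ht.2⟩

/-- An upper set in `[0,1)` lies between `(c,1)` and `[c,1]` for its infimum `c`, so strict bounds
on these intervals give a strict bound on the set. -/
theorem measure_lt_of_tail_lt {m ν : Measure ℝ} {g : ℝ → ℝ} (hmono : MonotoneOn g (Ico 0 1))
    (hzero : ∀ z ∉ Ico (0 : ℝ) 1, g z = 0)
    (htail : ∀ c ∈ Ico (0 : ℝ) 1, m (Icc c 1) < ν (Ioo c 1)) {t : ℝ} (ht : 0 < t)
    (hne : {z | t < g z}.Nonempty) : m {z | t < g z} < ν {z | t < g z} := by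
  have hsub : ∀ z, t < g z → z ∈ Ico (0 : ℝ) 1 := fun z hz => by
    by_contra h
    rw [hzero z h] at hz
    exact lt_asymm ht hz
  have hbdd : BddBelow {z | t < g z} := ⟨0, fun z hz => (hsub z hz).1⟩
  set c := sInf {z | t < g z}
  obtain ⟨z, hz⟩ := hne
  have hc : c ∈ Ico (0 : ℝ) 1 :=
    ⟨le_csInf ⟨z, hz⟩ fun y hy => (hsub y hy).1, (csInf_le hbdd hz).trans_lt (hsub z hz).2⟩
  calc m {z | t < g z} ≤ m (Icc c 1) :=
        measure_mono fun y hy => ⟨csInf_le hbdd hy, (hsub y hy).2.le⟩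
    _ < ν (Ioo c 1) := htail c hc
    _ ≤ ν {z | t < g z} := measure_mono fun y hy => by
        obtain ⟨a, ha, hay⟩ := exists_lt_of_csInf_lt ⟨z, hz⟩ hy.1
        exact lt_of_lt_of_le ha
          (hmono (hsub a ha) ⟨hc.1.trans hy.1.le, hy.2⟩ hay.le)

/-- The extension of `G` from `(0,1)` to `ℝ` with value `L` at `0` and value `0` off `[0,1)`. -/
def extendAtZero (L : ℝ) (G : ℝ → ℝ) : ℝ → ℝ :=
  fun z => if z = 0 then L else if z ∈ Ioo (0 : ℝ) 1 then G z else 0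

section Extend

variable {L : ℝ} {G : ℝ → ℝ}

theorem extendAtZero_zero : extendAtZero L G 0 = L := by simp [extendAtZero]

theorem extendAtZero_of_mem {z : ℝ} (hz : z ∈ Ioo (0 : ℝ) 1) : extendAtZero L G z = G z := by
  simp [extendAtZero, hz.1.ne', hz.1, hz.2]

theorem extendAtZero_of_notMem {z : ℝ} (hz : z ∉ Ico (0 : ℝ) 1) : extendAtZero L G z = 0 := by
  have h0 : z ≠ 0 := by
    rintro rfl
    simp at hz
  rw [extendAtZero, if_neg h0, if_neg fun h => hz ⟨h.1.le, h.2⟩]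

theorem limit_le_of_monotoneOn (hG : MonotoneOn G (Ioo 0 1)) (hL : Tendsto G (𝓝[>] 0) (𝓝 L))
    {z : ℝ} (hz : z ∈ Ioo (0 : ℝ) 1) : L ≤ G z := by
  refine le_of_tendsto hL ?_
  filter_upwards [Ioo_mem_nhdsGT hz.1] with y hy
  exact hG ⟨hy.1, hy.2.trans hz.2⟩ hz hy.2.le

theorem extendAtZero_nonneg (hG : MonotoneOn G (Ioo 0 1)) (hL : Tendsto G (𝓝[>] 0) (𝓝 L))
    (hL0 : 0 ≤ L) (z : ℝ) : 0 ≤ extendAtZero L G z := by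
  unfold extendAtZero
  split_ifs with h0 h1
  · exact hL0
  · exact hL0.trans (limit_le_of_monotoneOn hG hL h1)
  · exact le_rfl

theorem monotoneOn_extendAtZero (hG : MonotoneOn G (Ioo 0 1)) (hL : Tendsto G (𝓝[>] 0) (𝓝 L)) :
    MonotoneOn (extendAtZero L G) (Ico 0 1) := by
  intro a ha b hb hab
  rcases ha.1.eq_or_lt with rfl | ha0
  · rcases hb.1.eq_or_lt with rfl | hb0
    · exact le_rfl
    · rw [extendAtZero_zero, extendAtZero_of_mem ⟨hb0, hb.2⟩]
      exact limit_le_of_monotoneOn hG hL ⟨hb0, hb.2⟩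
  · have ha' : a ∈ Ioo (0 : ℝ) 1 := ⟨ha0, ha.2⟩
    have hb' : b ∈ Ioo (0 : ℝ) 1 := ⟨ha0.trans_le hab, hb.2⟩
    rw [extendAtZero_of_mem ha', extendAtZero_of_mem hb']
    exact hG ha' hb' hab

theorem Gbar_le_extendAtZero (hL : Tendsto G (𝓝[>] 0) (𝓝 L)) {z : ℝ} (hz : z ∈ Ico (0 : ℝ) 1) :
    Gbar G z ≤ ENNReal.ofReal (extendAtZero L G z) := by
  rcases hz.1.eq_or_lt with rfl | hz0
  · rw [extendAtZero_zero, Gbar, if_pos rfl]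
    refine ge_of_tendsto ((ENNReal.continuous_ofReal.tendsto L).comp hL) ?_
    filter_upwards [Ioo_mem_nhdsGT one_pos] with y hy
    exact iInf₂_le y hy
  · rw [extendAtZero_of_mem ⟨hz0, hz.2⟩, Gbar, if_neg hz0.ne', if_neg hz.2.ne]

end Extend

theorem withDensity_Ioo_eq_ofReal_integral {f : ℝ → ℝ} (hpos : ∀ z ∈ Ioo (0 : ℝ) 1, 0 < f z)
    (hint : IntervalIntegrable f volume 0 1) {c : ℝ} (hc : c ∈ Ico (0 : ℝ) 1) :
    (volume.restrict (Ioo (0 : ℝ) 1)).withDensity (fun z => ENNReal.ofReal (f z)) (Ioo c 1)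
      = ENNReal.ofReal (∫ z in c..1, f z) := by
  have hsub : Ioo c 1 ⊆ Ioo (0 : ℝ) 1 := Ioo_subset_Ioo_left hc.1
  have hi : IntegrableOn f (Ioo c 1) :=
    ((intervalIntegrable_iff_integrableOn_Ioo_of_le zero_le_one).1 hint).mono_set hsub
  rw [withDensity_apply _ measurableSet_Ioo, Measure.restrict_restrict measurableSet_Ioo,
    inter_eq_left.2 hsub, intervalIntegral.integral_of_le hc.2.le, integral_Ioc_eq_integral_Ioo,
    ofReal_integral_eq_lintegral_ofReal hi]
  exact (ae_restrict_iff' measurableSet_Ioo).2 (.of_forall fun z hz => (hpos z (hsub hz)).le)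

theorem measure_singleton_one_eq_zero {m : Measure ℝ} [IsProbabilityMeasure m] {f : ℝ → ℝ} {γ : ℝ}
    (hint : IntervalIntegrable f volume 0 1)
    (hlt : ∀ c ∈ Ioo (0 : ℝ) 1, (m (Icc c 1)).toReal < γ * ∫ z in c..1, f z) :
    m {1} = 0 := by
  have hlim : Tendsto (fun c => γ * ∫ z in c..1, f z) (𝓝[<] 1) (𝓝 (γ * 0)) := by
    refine Tendsto.const_mul γ ?_
    have h := intervalIntegral.continuousOn_primitive_interval_left (μ := volume) (f := f)
      (a := 0) (b := 1) (by
        rw [uIcc_of_le zero_le_one]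
        exact (intervalIntegrable_iff_integrableOn_Icc_of_le zero_le_one).1 hint)
    have h1 := (h 1 right_mem_uIcc).tendsto
    rw [intervalIntegral.integral_same, uIcc_of_le zero_le_one] at h1
    rw [← nhdsWithin_Ioo_eq_nhdsLT (zero_lt_one (α := ℝ))]
    exact h1.mono_left (nhdsWithin_mono _ Ioo_subset_Icc_self)
  have hle : (m {1}).toReal ≤ γ * 0 := by
    refine ge_of_tendsto hlim ?_
    filter_upwards [Ioo_mem_nhdsLT zero_lt_one] with c hc
    refine le_trans (ENNReal.toReal_mono (measure_ne_top _ _) (measure_mono ?_)) (hlt c hc).le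
    simpa using hc.2.le
  rw [mul_zero] at hle
  exact ((ENNReal.toReal_eq_zero_iff _).1 (le_antisymm hle ENNReal.toReal_nonneg)).resolve_right
    (measure_ne_top _ _)

/-- if `1/δ < γ* < +∞` and `ζ(c) < γ*` for every `c ∈ (0,1)`, then every
feasible quantile function that is not constant on `(0,1)` has objective value strictly
less than `γ*·x`. -/
theorem nonconstant_feasible_strictly_below
    {Ω : Type*} [MeasurableSpace Ω] (μ : Measure Ω) [IsProbabilityMeasure μ]
    (ρ : Ω → ℝ) (hρmeas : Measurable ρ) (hρpos : ∀ ω, 0 < ρ ω)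
    (hρint : Integrable ρ μ) (hcdf : Continuous (cdfFun μ ρ))
    (m : Measure ℝ) [IsProbabilityMeasure m] (hm : m (Set.Icc (0:ℝ) 1)ᶜ = 0)
    (x δ : ℝ) (hx : 0 < x) (hδpos : 0 < δ)
    (hδ1 : δ = ∫ ω, ρ ω ∂μ) (hδ2 : δ = ∫ z in (0:ℝ)..1, rcInv μ ρ (1 - z))
    (γstar : ℝ) (hlub : IsLUB (zeta (rcInv μ ρ) m '' Set.Ioo 0 1) γstar)
    (hgt : 1 / δ < γstar)
    (hna : ∀ c ∈ Set.Ioo (0:ℝ) 1, zeta (rcInv μ ρ) m c < γstar)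
    (G : ℝ → ℝ) (hG : Feasible (rcInv μ ρ) x G)
    (hnc : ∃ z ∈ Set.Ioo (0:ℝ) 1, ∃ w ∈ Set.Ioo (0:ℝ) 1, G z ≠ G w) :
    objVal m G < ENNReal.ofReal (γstar * x) := by
  set f : ℝ → ℝ := fun z => rcInv μ ρ (1 - z)
  have hfpos : ∀ z ∈ Ioo (0 : ℝ) 1, 0 < f z := fun z hz =>
    rcInv_pos_s7 hρmeas hρpos hcdf ⟨by linarith [hz.2], by linarith [hz.1]⟩
  have hfint : IntervalIntegrable f volume 0 1 := by
    by_contra h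
    exact hδpos.ne' (hδ2.trans (intervalIntegral.integral_undef h))
  have hγ : 0 < γstar := (one_div_pos.2 hδpos).trans hgt
  have hlt : ∀ c ∈ Ioo (0 : ℝ) 1, (m (Icc c 1)).toReal < γstar * ∫ z in c..1, f z := by
    intro c hc
    refine (div_lt_iff₀ ?_).1 (hna c hc)
    refine intervalIntegral.intervalIntegral_pos_of_pos_on (hfint.mono_set ?_)
      (fun z hz => hfpos z ⟨hc.1.trans hz.1, hz.2⟩) hc.2
    rw [uIcc_of_le hc.2.le, uIcc_of_le zero_le_one]
    exact Icc_subset_Icc_left hc.1.le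
  have hlt0 : ∀ c ∈ Ico (0 : ℝ) 1, (m (Icc c 1)).toReal < γstar * ∫ z in c..1, f z := by
    intro c hc
    rcases hc.1.eq_or_lt with rfl | h0
    · refine lt_of_le_of_lt measureReal_le_one ?_
      rw [← hδ2]
      exact (div_lt_iff₀ hδpos).1 hgt
    · exact hlt c ⟨h0, hc.2⟩
  obtain ⟨hmono, -, ⟨L, hL0, hL⟩, hbudget⟩ := hG
  have hm1 : m {1} = 0 := measure_singleton_one_eq_zero hfint hlt
  have hae : ∀ᵐ z ∂m, z ∈ Ico (0 : ℝ) 1 := by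
    filter_upwards [mem_ae_iff.2 hm, measure_eq_zero_iff_ae_notMem.1 hm1] with z hz hz1
    exact ⟨hz.1, hz.2.lt_of_ne hz1⟩
  set g := extendAtZero L G
  set ν := (volume.restrict (Ioo (0 : ℝ) 1)).withDensity fun z => ENNReal.ofReal (f z)
  have hgmono : MonotoneOn g (Ico 0 1) := monotoneOn_extendAtZero hmono hL
  have hgm : AEMeasurable g m := by
    have := aemeasurable_restrict_of_monotoneOn (μ := m) measurableSet_Ico hgmono
    rwa [Measure.restrict_eq_self_of_ae_mem hae] at this
  have hgvol : AEMeasurable g (volume.restrict (Ioo (0 : ℝ) 1)) :=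
    aemeasurable_restrict_of_monotoneOn measurableSet_Ioo (hgmono.mono Ioo_subset_Ico_self)
  have hfvol : AEMeasurable (fun z => ENNReal.ofReal (f z)) (volume.restrict (Ioo (0 : ℝ) 1)) :=
    ((intervalIntegrable_iff_integrableOn_Ioo_of_le zero_le_one).1 hfint).aemeasurable.ennreal_ofReal
  have hgν : AEMeasurable g ν := hgvol.mono_ac (withDensity_absolutelyContinuous _ _)
  have hνg : ∫⁻ z, ENNReal.ofReal (g z) ∂ν ≤ ENNReal.ofReal x := by
    refine le_trans (le_of_eq ?_) hbudget
    rw [lintegral_withDensity_eq_lintegral_mul₀ hfvol hgvol.ennreal_ofReal]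
    refine setLIntegral_congr_fun measurableSet_Ioo fun z hz => ?_
    simp only [Pi.mul_apply]
    rw [← ENNReal.ofReal_mul (hfpos z hz).le, show g z = G z from extendAtZero_of_mem hz]
  have hscaled : ∫⁻ z, ENNReal.ofReal (g z) ∂(ENNReal.ofReal γstar • ν)
      ≤ ENNReal.ofReal (γstar * x) := by
    rw [lintegral_smul_measure, ENNReal.ofReal_mul hγ.le, smul_eq_mul]
    gcongr
  have hgnonneg : ∀ z, 0 ≤ g z := extendAtZero_nonneg hmono hL hL0
  obtain ⟨w, hw⟩ : ∃ w, 0 < g w := by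
    obtain ⟨a, ha, b, hb, hab⟩ := hnc
    by_contra! h
    have h0 : ∀ z ∈ Ioo (0 : ℝ) 1, G z = 0 := fun z hz =>
      (extendAtZero_of_mem hz).symm.trans (le_antisymm (h z) (hgnonneg z))
    exact hab ((h0 a ha).trans (h0 b hb).symm)
  calc objVal m G ≤ ∫⁻ z, ENNReal.ofReal (g z) ∂m :=
        lintegral_mono_ae (hae.mono fun z hz => Gbar_le_extendAtZero hL hz)
    _ < ∫⁻ z, ENNReal.ofReal (g z) ∂(ENNReal.ofReal γstar • ν) := by
        refine lintegral_lt_of_tail_lt hgnonneg hgm (hgν.smul_measure _) (fun t ht hne => ?_) hw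
          (ne_top_of_le_ne_top ENNReal.ofReal_ne_top hscaled)
        refine measure_lt_of_tail_lt hgmono (fun z hz => extendAtZero_of_notMem hz)
          (fun c hc => ?_) ht hne
        rw [Measure.smul_apply, withDensity_Ioo_eq_ofReal_integral hfpos hfint hc, smul_eq_mul,
          ← ENNReal.ofReal_mul hγ.le]
        exact (ENNReal.lt_ofReal_iff_toReal_lt (measure_ne_top _ _)).2 (hlt0 c hc)
    _ ≤ ENNReal.ofReal (γstar * x) := hscaled
end
end
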